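/- arXiv:2012.12154 — 2 statements merged into one kernel-verified Lean document; each statement's English description precedes it below -/
import Mathlib

section
/- Let 0 < d, 2d ≤ s, and let X, Y be independent random variables each uniformly distributed on [0,s]. If r satisfies d/s ≤ r ≤ 1 − d/s and d/(2s) ≤ r(1−r), then the diversified position ν = (1−r)X + rY satisfies P(ν < d) ≤ P(X < d). (Part (ii) of Proposition 1.) -/
open MeasureTheory ProbabilityTheory Set

/-- The uniform probability distribution on the interval `[0, s]`. -/
noncomputable def uniformOnIcc (s : ℝ) : Measure ℝ :=
  (ENNReal.ofReal s)⁻¹ • (volume.restrict (Icc (0 : ℝ) s))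

/-- if `d/s ≤ r ≤ 1 - d/s` and `d/(2s) ≤ r(1-r)`, then the diversified
position `ν = (1-r)X + rY` satisfies `P(ν < d) ≤ P(X < d)`. (Part (ii) of Proposition 1.) -/
theorem diversification_reduces_individual_default_large_r
    {Ω : Type*} [MeasurableSpace Ω] (P : Measure Ω) [IsProbabilityMeasure P]
    (s d : ℝ) (hd : 0 < d) (hs : 2 * d ≤ s)
    (X Y : Ω → ℝ) (hXm : Measurable X) (hYm : Measurable Y)
    (hX : P.map X = uniformOnIcc s) (hY : P.map Y = uniformOnIcc s)
    (hXY : IndepFun X Y P)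
    (r : ℝ) (hr0 : d / s ≤ r) (hr1 : r ≤ 1 - d / s)
    (hr2 : d / (2 * s) ≤ r * (1 - r)) :
    P {ω | (1 - r) * X ω + r * Y ω < d} ≤ P {ω | X ω < d} := by
  have hs0 : 0 < s := by linarith
  have hds : 0 < d / s := by positivity
  have hr : 0 < r := by linarith
  have hq : 0 < 1 - r := by linarith
  set c : ENNReal := (ENNReal.ofReal s)⁻¹ with hc
  have hprod := (indepFun_iff_map_prod_eq_prod_map_map hXm.aemeasurable hYm.aemeasurable).1 hXY
  haveI : IsProbabilityMeasure (uniformOnIcc s) := by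
    rw [← hX]; exact Measure.isProbabilityMeasure_map hXm.aemeasurable
  have hA : MeasurableSet {p : ℝ × ℝ | (1 - r) * p.1 + r * p.2 < d} :=
    measurableSet_lt (by fun_prop) (by fun_prop)
  have hL : P {ω | (1 - r) * X ω + r * Y ω < d}
      = ∫⁻ x, uniformOnIcc s {y | (1 - r) * x + r * y < d} ∂(uniformOnIcc s) := by
    have h1 : P {ω | (1 - r) * X ω + r * Y ω < d}
        = (P.map (fun ω => (X ω, Y ω))) {p : ℝ × ℝ | (1 - r) * p.1 + r * p.2 < d} := by
      rw [Measure.map_apply (hXm.prodMk hYm) hA]; rfl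
    rw [h1, hprod, hX, hY, Measure.prod_apply hA]; rfl
  have hR : P {ω | X ω < d} = c * ENNReal.ofReal d := by
    have h1 : P {ω | X ω < d} = (P.map X) (Iio d) := by
      rw [Measure.map_apply hXm measurableSet_Iio]; rfl
    have h2 : Iio d ∩ Icc 0 s = Ico 0 d := by
      ext x; simp only [mem_inter_iff, mem_Iio, mem_Icc, mem_Ico]
      constructor
      · rintro ⟨a, b, e⟩; exact ⟨b, a⟩
      · rintro ⟨a, b⟩; exact ⟨b, a, by linarith⟩
    rw [h1, hX, uniformOnIcc, Measure.smul_apply, Measure.restrict_apply measurableSet_Iio, h2,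
      Real.volume_Ico, sub_zero, smul_eq_mul]
  have hin : ∀ x, uniformOnIcc s {y | (1 - r) * x + r * y < d}
      ≤ c * ENNReal.ofReal ((d - (1 - r) * x) / r) := by
    intro x
    have hm : MeasurableSet {y : ℝ | (1 - r) * x + r * y < d} :=
      measurableSet_lt (by fun_prop) (by fun_prop)
    rw [uniformOnIcc, Measure.smul_apply, Measure.restrict_apply hm, smul_eq_mul]
    gcongr
    calc _ ≤ volume (Icc 0 ((d - (1 - r) * x) / r)) := by
          apply measure_mono
          rintro y ⟨h1, h2⟩
          refine ⟨h2.1, ?_⟩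
          rw [le_div_iff₀ hr]
          simp only [mem_setOf_eq] at h1
          linarith
      _ = _ := by rw [Real.volume_Icc, sub_zero]
  have hfc : Continuous (fun x : ℝ => (d - (1 - r) * x) / r) := by fun_prop
  have ha : 0 ≤ d / (1 - r) := by positivity
  have hint : ∫⁻ x in Icc 0 s, ENNReal.ofReal ((d - (1 - r) * x) / r)
      ≤ ENNReal.ofReal (d ^ 2 / (2 * r * (1 - r))) := by
    have hsub : Icc 0 s ⊆ Icc 0 (d / (1 - r)) ∪ Ioi (d / (1 - r)) := by
      intro x hx
      rcases le_or_gt x (d / (1 - r)) with h | h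
      · exact Or.inl ⟨hx.1, h⟩
      · exact Or.inr h
    have hz : ∫⁻ x in Ioi (d / (1 - r)), ENNReal.ofReal ((d - (1 - r) * x) / r) = 0 := by
      rw [setLIntegral_congr_fun (g := fun _ => 0) measurableSet_Ioi]
      · simp
      · intro x hx
        have : d < x * (1 - r) := (div_lt_iff₀ hq).1 hx
        apply ENNReal.ofReal_of_nonpos
        apply div_nonpos_of_nonpos_of_nonneg _ hr.le
        linarith
    have hmain : ∫⁻ x in Icc 0 (d / (1 - r)), ENNReal.ofReal ((d - (1 - r) * x) / r)
        = ENNReal.ofReal (d ^ 2 / (2 * r * (1 - r))) := by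
      rw [← ofReal_integral_eq_lintegral_ofReal]
      · congr 1
        rw [integral_Icc_eq_integral_Ioc, ← intervalIntegral.integral_of_le ha,
          intervalIntegral.integral_div, intervalIntegral.integral_sub (by simp)
            ((by fun_prop : Continuous fun x : ℝ => (1 - r) * x).intervalIntegrable _ _),
          intervalIntegral.integral_const_mul, integral_id, intervalIntegral.integral_const,
          smul_eq_mul]
        field_simp
        ring
      · exact hfc.continuousOn.integrableOn_Icc
      · refine (ae_restrict_iff' measurableSet_Icc).2 (Filter.Eventually.of_forall ?_)
        intro x hx
        have : x * (1 - r) ≤ d := (le_div_iff₀ hq).1 hx.2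
        apply div_nonneg _ hr.le
        linarith
    calc _ ≤ _ := lintegral_mono_set hsub
      _ ≤ _ := lintegral_union_le _ _ _
      _ = _ := by rw [hz, hmain, add_zero]
  rw [hL, hR]
  calc _ ≤ ∫⁻ x, c * ENNReal.ofReal ((d - (1 - r) * x) / r) ∂(uniformOnIcc s) :=
        lintegral_mono hin
    _ = c * (c * ∫⁻ x in Icc 0 s, ENNReal.ofReal ((d - (1 - r) * x) / r)) := by
        rw [lintegral_const_mul _ (by fun_prop), uniformOnIcc, lintegral_smul_measure, smul_eq_mul]
    _ ≤ c * (c * ENNReal.ofReal (d ^ 2 / (2 * r * (1 - r)))) := by gcongr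
    _ ≤ c * ENNReal.ofReal d := by
        gcongr
        rw [hc, ← ENNReal.ofReal_inv_of_pos hs0, ← ENNReal.ofReal_mul (by positivity)]
        apply ENNReal.ofReal_le_ofReal
        rw [div_le_iff₀ (by positivity)] at hr2
        rw [inv_mul_le_iff₀ hs0, div_le_iff₀ (by positivity)]
        nlinarith
end

section
/- Let 0 < d, let X and Y be independent random variables each uniformly distributed on [0,s], and let r₁, r₂ ∈ [0,1] satisfy 2d ≤ s(1 − r₁ + r₂) and 2d ≤ s(1 + r₁ − r₂). Then the aggregate position R_total = (1−r₁+r₂)X + (1+r₁−r₂)Y − 2d satisfies P(R_total ≤ 0) = 2d² / (s²(1 − r₁ + r₂)(1 + r₁ − r₂)). -/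
open MeasureTheory ProbabilityTheory Set

/-- if `2d ≤ s(1 - r₁ + r₂)` and `2d ≤ s(1 + r₁ - r₂)`, the aggregate
position `R_total = (1-r₁+r₂)X + (1+r₁-r₂)Y - 2d` satisfies
`P(R_total ≤ 0) = 2d² / (s²(1-r₁+r₂)(1+r₁-r₂))`. -/
theorem prob_aggregate_loss
    {Ω : Type*} [MeasurableSpace Ω] (P : Measure Ω) [IsProbabilityMeasure P]
    (s d : ℝ) (hd : 0 < d)
    (X Y : Ω → ℝ) (hXm : Measurable X) (hYm : Measurable Y)
    (hX : P.map X = uniformOnIcc s) (hY : P.map Y = uniformOnIcc s)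
    (hXY : IndepFun X Y P)
    (r₁ r₂ : ℝ) (hr₁ : r₁ ∈ Icc (0 : ℝ) 1) (hr₂ : r₂ ∈ Icc (0 : ℝ) 1)
    (h1 : 2 * d ≤ s * (1 - r₁ + r₂)) (h2 : 2 * d ≤ s * (1 + r₁ - r₂)) :
    P {ω | (1 - r₁ + r₂) * X ω + (1 + r₁ - r₂) * Y ω - 2 * d ≤ 0}
      = ENNReal.ofReal (2 * d ^ 2 / (s ^ 2 * (1 - r₁ + r₂) * (1 + r₁ - r₂))) := by
  obtain ⟨ha1, ha2⟩ := hr₁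
  obtain ⟨hb1, hb2⟩ := hr₂
  have ha0 : 0 ≤ 1 - r₁ + r₂ := by linarith
  have hb0 : 0 ≤ 1 + r₁ - r₂ := by linarith
  generalize 1 - r₁ + r₂ = a at *
  generalize 1 + r₁ - r₂ = b at *
  have hs : 0 < s := by
    by_contra h
    nlinarith [mul_nonneg (sub_nonneg.2 (not_lt.1 h)) ha0]
  have ha : 0 < a := by
    rcases ha0.lt_or_eq with h | h
    · exact h
    · rw [← h] at h1; linarith
  have hb : 0 < b := by
    rcases hb0.lt_or_eq with h | h
    · exact h
    · rw [← h] at h2; linarith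
  have hS : MeasurableSet {p : ℝ × ℝ | a * p.1 + b * p.2 - 2 * d ≤ 0} :=
    measurableSet_le (by fun_prop) measurable_const
  have hpre : {ω | a * X ω + b * Y ω - 2 * d ≤ 0}
      = (fun ω => (X ω, Y ω)) ⁻¹' {p : ℝ × ℝ | a * p.1 + b * p.2 - 2 * d ≤ 0} := rfl
  have : IsProbabilityMeasure (P.map Y) := Measure.isProbabilityMeasure_map hYm.aemeasurable
  rw [hpre, ← Measure.map_apply (hXm.prodMk hYm) hS,
    (indepFun_iff_map_prod_eq_prod_map_map hXm.aemeasurable hYm.aemeasurable).1 hXY,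
    Measure.prod_apply hS, hX, hY, uniformOnIcc, lintegral_smul_measure]
  have key : ∫⁻ x in Icc 0 s, ((ENNReal.ofReal s)⁻¹ • volume.restrict (Icc (0 : ℝ) s))
      (Prod.mk x ⁻¹' {p : ℝ × ℝ | a * p.1 + b * p.2 - 2 * d ≤ 0})
      = ∫⁻ x in Icc 0 s, (ENNReal.ofReal s)⁻¹ * ENNReal.ofReal ((2 * d - a * x) / b) := by
    refine setLIntegral_congr_fun measurableSet_Icc ?_
    intro x hx
    have hset : (Prod.mk x ⁻¹' {p : ℝ × ℝ | a * p.1 + b * p.2 - 2 * d ≤ 0}) ∩ Icc 0 s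
        = Icc 0 ((2 * d - a * x) / b) := by
      ext y
      simp only [mem_inter_iff, mem_preimage, mem_ofPred_eq, mem_Icc]
      rw [le_div_iff₀ hb]
      constructor
      · rintro ⟨h, h0, -⟩
        exact ⟨h0, by linarith⟩
      · rintro ⟨h0, h⟩
        refine ⟨by linarith, h0, ?_⟩
        by_contra hc
        nlinarith [mul_nonneg ha.le hx.1, mul_pos hb (sub_pos.2 (not_le.1 hc))]
    simp only [Measure.smul_apply, smul_eq_mul]
    rw [Measure.restrict_apply (measurable_prodMk_left hS), hset, Real.volume_Icc, sub_zero]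
  have hts : 2 * d / a ≤ s := by rw [div_le_iff₀ ha]; linarith
  have ht0 : 0 ≤ 2 * d / a := by positivity
  have hint : ∫⁻ x in Icc 0 s, ENNReal.ofReal ((2 * d - a * x) / b)
      = ENNReal.ofReal (2 * d ^ 2 / (a * b)) := by
    have h3 : ∫⁻ x in Icc 0 s, ENNReal.ofReal ((2 * d - a * x) / b)
        = ∫⁻ x in Icc 0 (2 * d / a), ENNReal.ofReal ((2 * d - a * x) / b) := by
      rw [← lintegral_indicator measurableSet_Icc, ← lintegral_indicator measurableSet_Icc]
      congr 1
      ext x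
      by_cases hx : x ∈ Icc 0 (2 * d / a)
      · rw [indicator_of_mem hx, indicator_of_mem (show x ∈ Icc 0 s from ⟨hx.1, hx.2.trans hts⟩)]
      · rw [indicator_of_notMem hx]
        by_cases hx' : x ∈ Icc 0 s
        · rw [indicator_of_mem hx']
          have : 2 * d / a < x := by
            by_contra hc
            exact hx ⟨hx'.1, not_lt.1 hc⟩
          rw [div_lt_iff₀ ha] at this
          exact ENNReal.ofReal_of_nonpos (div_nonpos_of_nonpos_of_nonneg (by linarith) hb.le)
        · rw [indicator_of_notMem hx']
    have hcont : Continuous fun x : ℝ => (2 * d - a * x) / b := by fun_prop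
    rw [h3, ← ofReal_integral_eq_lintegral_ofReal]
    · rw [integral_Icc_eq_integral_Ioc, ← intervalIntegral.integral_of_le ht0]
      congr 1
      rw [intervalIntegral.integral_div, intervalIntegral.integral_sub (by simp)
        (Continuous.intervalIntegrable (by fun_prop) _ _),
        intervalIntegral.integral_const_mul a, integral_id, intervalIntegral.integral_const]
      simp only [smul_eq_mul]
      field_simp
      ring
    · exact hcont.continuousOn.integrableOn_Icc
    · refine (ae_restrict_iff' measurableSet_Icc).2 (Filter.Eventually.of_forall ?_)
      intro x hx
      have := hx.2
      rw [le_div_iff₀ ha] at this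
      exact div_nonneg (by linarith) hb.le
  rw [key, lintegral_const_mul _ (by fun_prop), hint, smul_eq_mul, ← ENNReal.ofReal_inv_of_pos hs,
    ← ENNReal.ofReal_mul (by positivity), ← ENNReal.ofReal_mul (by positivity)]
  congr 1
  field_simp
end
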